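/- Let n ≥ 1 and let ω: (0,∞) → ℝ be (n−1)-times continuously differentiable. Let s ∈ ℂ^n and assume for all 0 ≤ j ≤ n−1 and all c ∈ {1,…,n}: ∫_0^∞ x^{Re s_c} |((x d/dx)^j ω)(x)| dx < ∞ and x^{Re s_c + 1} · ((x d/dx)^j ω)(x) → 0 as x → 0+ and as x → ∞. Set w_b = (−x d/dx)^{b−1} ω for b = 1,…,n. Then (1/n!) ∫_{(0,∞)^n} det[ w_b(a_c) ]_{b,c=1,…,n} · det[ a_c^{s_b} ]_{b,c=1,…,n} da = Δ_n(s) · ∏_{c=1}^{n} Mω(s_c + 1). (This is the product formula for the spherical transform of a Pólya ensemble.) -/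

import Mathlib

open MeasureTheory Finset Filter Set

noncomputable section

namespace RMT

/-- The operator `f ↦ x·f'`. -/
def xdOp (f : ℝ → ℝ) : ℝ → ℝ := fun x => x * deriv f x

/-- The operator `f ↦ -x·f'`. -/
def negxdOp (f : ℝ → ℝ) : ℝ → ℝ := fun x => -(x * deriv f x)

/-- The Mellin transform `Mω(s) = ∫_0^∞ x^{s-1} ω(x) dx`. -/
def mellinPos (ω : ℝ → ℝ) (s : ℂ) : ℂ :=
  ∫ x in Set.Ioi (0 : ℝ), ((x : ℂ) ^ (s - 1)) * (ω x : ℂ)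

/-- The Vandermonde determinant `Δ_n(s) = ∏_{c>d}(s_c - s_d)`. -/
def VdmCF {n : ℕ} (s : Fin n → ℂ) : ℂ := ∏ c : Fin n, ∏ d ∈ Finset.Iio c, (s c - s d)

lemma negxd_eq (ω : ℝ → ℝ) (j : ℕ) :
    negxdOp^[j] ω = fun x => (-1 : ℝ) ^ j * (xdOp^[j] ω) x := by
  induction j with
  | zero => simp
  | succ j ih =>
    rw [Function.iterate_succ_apply', Function.iterate_succ_apply', ih]
    funext x
    simp only [negxdOp, xdOp, deriv_const_mul_field']
    ring

lemma xd_contDiffOn (ω : ℝ → ℝ) (m : ℕ) (j : ℕ) :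
    ∀ k : ℕ, ContDiffOn ℝ ((j + k : ℕ) : ℕ∞) ω (Set.Ioi 0) →
      ContDiffOn ℝ (k : ℕ∞) (negxdOp^[j] ω) (Set.Ioi 0) := by
  induction j with
  | zero => intro k h; simpa using h
  | succ j ih =>
    intro k h
    have h1 := ih (k + 1) (by convert h using 3; ring)
    rw [Function.iterate_succ_apply']
    have h2 : ContDiffOn ℝ (k : ℕ∞) (deriv (negxdOp^[j] ω)) (Set.Ioi 0) :=
      h1.deriv_of_isOpen isOpen_Ioi (by norm_cast)
    exact (contDiffOn_id.mul h2).neg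

lemma integrable_aux (f : ℝ → ℝ) (s : ℂ) (hc : ContinuousOn f (Set.Ioi 0))
    (hi : IntegrableOn (fun x : ℝ => x ^ s.re * |f x|) (Set.Ioi 0)) :
    IntegrableOn (fun x : ℝ => (x : ℂ) ^ s * (f x : ℂ)) (Set.Ioi 0) := by
  have hm : AEStronglyMeasurable (fun x : ℝ => (x : ℂ) ^ s * (f x : ℂ))
      (volume.restrict (Set.Ioi 0)) := by
    refine ContinuousOn.aestronglyMeasurable ?_ measurableSet_Ioi
    refine ContinuousOn.mul ?_ (Complex.continuous_ofReal.comp_continuousOn hc)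
    exact fun x hx => (Complex.continuousAt_ofReal_cpow_const _ _
      (Or.inr (ne_of_gt hx))).continuousWithinAt
  rw [IntegrableOn, ← integrable_norm_iff hm, ← IntegrableOn]
  refine (integrableOn_congr_fun (fun x hx => ?_) measurableSet_Ioi).mpr hi
  simp [Complex.norm_cpow_eq_rpow_re_of_pos hx]

lemma ibp (f : ℝ → ℝ) (s : ℂ) (hd : ∀ x ∈ Set.Ioi (0 : ℝ), DifferentiableAt ℝ f x)
    (h1 : IntegrableOn (fun x : ℝ => (x : ℂ) ^ s * (f x : ℂ)) (Set.Ioi 0))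
    (h2 : IntegrableOn (fun x : ℝ => (x : ℂ) ^ s * (negxdOp f x : ℂ)) (Set.Ioi 0))
    (h0 : Tendsto (fun x : ℝ => x ^ (s.re + 1) * f x) (nhdsWithin 0 (Set.Ioi 0)) (nhds 0))
    (ht : Tendsto (fun x : ℝ => x ^ (s.re + 1) * f x) atTop (nhds 0)) :
    ∫ x in Set.Ioi (0 : ℝ), (x : ℂ) ^ s * (negxdOp f x : ℂ) =
      (s + 1) * ∫ x in Set.Ioi (0 : ℝ), (x : ℂ) ^ s * (f x : ℂ) := by
  have hn : ∀ x ∈ Set.Ioi (0 : ℝ), ‖(x : ℂ) ^ (s + 1) * (f x : ℂ)‖ =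
      ‖x ^ (s.re + 1) * f x‖ := by
    intro x hx
    rw [norm_mul, norm_mul, Complex.norm_cpow_eq_rpow_re_of_pos hx, Complex.norm_real,
      Real.norm_of_nonneg (Real.rpow_nonneg (le_of_lt hx) _)]
    simp
  have hu : ∀ x ∈ Set.Ioi (0 : ℝ),
      HasDerivAt (fun x : ℝ => (x : ℂ) ^ (s + 1)) ((s + 1) * (x : ℂ) ^ s) x := by
    intro x hx
    have := (hasDerivAt_id (x : ℂ)).cpow_const (c := s + 1)
      (Or.inl (by simpa using hx))
    simpa using this.comp_ofReal
  have hv : ∀ x ∈ Set.Ioi (0 : ℝ),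
      HasDerivAt (fun x : ℝ => (f x : ℂ)) ((deriv f x : ℝ) : ℂ) x :=
    fun x hx => (hd x hx).hasDerivAt.ofReal_comp
  have hcp : ∀ x ∈ Set.Ioi (0 : ℝ), (x : ℂ) ^ s * (negxdOp f x : ℂ) =
      - ((x : ℂ) ^ (s + 1) * ((deriv f x : ℝ) : ℂ)) := by
    intro x hx
    have hx' : (x : ℂ) ≠ 0 := Complex.ofReal_ne_zero.mpr (ne_of_gt hx)
    rw [Complex.cpow_add _ _ hx', Complex.cpow_one, negxdOp]
    push_cast
    ring
  have h2' : IntegrableOn (fun x : ℝ => (x : ℂ) ^ (s + 1) * ((deriv f x : ℝ) : ℂ))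
      (Set.Ioi 0) := by
    refine (integrableOn_congr_fun (fun x hx => ?_) measurableSet_Ioi).mp h2.neg
    simp [hcp x hx]
  have h1' : IntegrableOn (fun x : ℝ => ((s + 1) * (x : ℂ) ^ s) * (f x : ℂ)) (Set.Ioi 0) := by
    simpa only [mul_assoc] using! h1.const_mul (s + 1)
  have key := integral_Ioi_mul_deriv_eq_deriv_mul (a' := (0 : ℂ)) (b' := 0) hu hv h2' h1'
    (by
      rw [tendsto_zero_iff_norm_tendsto_zero] at h0 ⊢
      refine h0.congr' ?_
      filter_upwards [self_mem_nhdsWithin] with x hx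
      exact (hn x hx).symm)
    (by
      rw [tendsto_zero_iff_norm_tendsto_zero] at ht ⊢
      refine ht.congr' ?_
      filter_upwards [Filter.Ioi_mem_atTop 0] with x hx
      exact (hn x hx).symm)
  rw [setIntegral_congr_fun measurableSet_Ioi hcp, integral_neg, key]
  simp only [mul_assoc, integral_const_mul]
  ring

lemma andreief (n : ℕ) (μ : Measure ℝ) [SigmaFinite μ] (f g : Fin n → ℝ → ℂ)
    (h : ∀ b c, Integrable (fun x => f b x * g c x) μ) :
    ∫ a, Matrix.det (Matrix.of fun b c : Fin n => f b (a c)) *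
        Matrix.det (Matrix.of fun b c : Fin n => g b (a c)) ∂(Measure.pi fun _ : Fin n => μ) =
      (n.factorial : ℂ) * Matrix.det (Matrix.of fun b c : Fin n => ∫ x, f b x * g c x ∂μ) := by
  set A : Matrix (Fin n) (Fin n) ℂ := Matrix.of fun b c : Fin n => ∫ x, f b x * g c x ∂μ with hA
  have e : ∀ a : Fin n → ℝ, Matrix.det (Matrix.of fun b c : Fin n => f b (a c)) *
        Matrix.det (Matrix.of fun b c : Fin n => g b (a c)) =
      ∑ τ : Equiv.Perm (Fin n), ∑ σ : Equiv.Perm (Fin n),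
        ((Equiv.Perm.sign τ : ℤ) : ℂ) * (((Equiv.Perm.sign σ : ℤ) : ℂ) *
          ∏ c, (f (σ c) (a c) * g (τ c) (a c))) := by
    intro a
    rw [Matrix.det_apply', Matrix.det_apply', Finset.sum_mul_sum, Finset.sum_comm]
    refine Finset.sum_congr rfl fun τ _ => Finset.sum_congr rfl fun σ _ => ?_
    simp only [Matrix.of_apply, Finset.prod_mul_distrib]
    ring
  have hI : ∀ σ τ : Equiv.Perm (Fin n), Integrable (fun a : Fin n → ℝ =>
      ((Equiv.Perm.sign τ : ℤ) : ℂ) * (((Equiv.Perm.sign σ : ℤ) : ℂ) *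
          ∏ c, (f (σ c) (a c) * g (τ c) (a c)))) (Measure.pi fun _ : Fin n => μ) := by
    intro σ τ
    exact ((Integrable.fintype_prod (fun c => h (σ c) (τ c))).const_mul _).const_mul _
  simp_rw [e]
  rw [integral_finsetSum _ (fun τ _ => integrable_finsetSum _ (fun σ _ => hI σ τ))]
  have : ∀ τ : Equiv.Perm (Fin n), ∫ a, ∑ σ : Equiv.Perm (Fin n),
        ((Equiv.Perm.sign τ : ℤ) : ℂ) * (((Equiv.Perm.sign σ : ℤ) : ℂ) *
          ∏ c, (f (σ c) (a c) * g (τ c) (a c))) ∂(Measure.pi fun _ : Fin n => μ) = A.det := by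
    intro τ
    rw [integral_finsetSum _ (fun σ _ => hI σ τ)]
    have hs : ((Equiv.Perm.sign τ : ℤ) : ℂ) * ((Equiv.Perm.sign τ : ℤ) : ℂ) = 1 := by
      rw [← Int.cast_mul, ← Units.val_mul, Int.units_mul_self]; simp
    have h1 := Matrix.det_permute' τ A
    rw [Matrix.det_apply'] at h1
    calc _ = ((Equiv.Perm.sign τ : ℤ) : ℂ) * ∑ σ : Equiv.Perm (Fin n),
          ((Equiv.Perm.sign σ : ℤ) : ℂ) * ∏ c, A.submatrix id τ (σ c) c := by
          rw [Finset.mul_sum]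
          refine Finset.sum_congr rfl fun σ _ => ?_
          rw [integral_const_mul, integral_const_mul,
            integral_fintype_prod_eq_prod (fun c x => f (σ c) x * g (τ c) x)]
          rfl
      _ = _ := by rw [h1, ← mul_assoc, hs, one_mul]
  simp_rw [this]
  simp [Fintype.card_perm]

lemma vdm_eq {n : ℕ} (s : Fin n → ℂ) : VdmCF s = (Matrix.vandermonde s).det := by
  rw [Matrix.det_vandermonde, VdmCF]
  refine Finset.prod_comm' ?_
  simp

/-- Product formula for the spherical transform of a Pólya ensemble:
`(1/n!) ∫_{(0,∞)^n} det[w_b(a_c)] det[a_c^{s_b}] da = Δ_n(s) ∏_c Mω(s_c+1)`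
with `w_b = (-x d/dx)^{b-1} ω`. -/
theorem statement10 (n : ℕ) (hn : 1 ≤ n) (ω : ℝ → ℝ)
    (hω : ContDiffOn ℝ ((n - 1 : ℕ) : ℕ∞) ω (Set.Ioi 0)) (s : Fin n → ℂ)
    (hint : ∀ j < n, ∀ c : Fin n,
      IntegrableOn (fun x : ℝ => x ^ (s c).re * |(xdOp^[j] ω) x|) (Set.Ioi 0))
    (hlim0 : ∀ j < n, ∀ c : Fin n,
      Tendsto (fun x : ℝ => x ^ ((s c).re + 1) * (xdOp^[j] ω) x)
        (nhdsWithin 0 (Set.Ioi 0)) (nhds 0))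
    (hlimtop : ∀ j < n, ∀ c : Fin n,
      Tendsto (fun x : ℝ => x ^ ((s c).re + 1) * (xdOp^[j] ω) x) atTop (nhds 0)) :
    (1 / (Nat.factorial n : ℂ)) *
        ∫ a in Set.pi Set.univ (fun _ : Fin n => Set.Ioi (0 : ℝ)),
          Matrix.det (Matrix.of fun b c : Fin n => ((negxdOp^[(b : ℕ)] ω) (a c) : ℂ)) *
            Matrix.det (Matrix.of fun b c : Fin n => ((a c : ℝ) : ℂ) ^ (s b)) =
      VdmCF s * ∏ c : Fin n, mellinPos ω (s c + 1) := by
  have hfc : (n.factorial : ℂ) ≠ 0 := by exact_mod_cast n.factorial_ne_zero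
  have hcont : ∀ j < n, ContinuousOn (negxdOp^[j] ω) (Set.Ioi 0) := by
    intro j hj
    refine (xd_contDiffOn ω 0 j (n - 1 - j) ?_).continuousOn
    convert hω using 3
    omega
  have hdiff : ∀ j, j + 1 < n → ∀ x ∈ Set.Ioi (0 : ℝ),
      DifferentiableAt ℝ (negxdOp^[j] ω) x := by
    intro j hj x hx
    refine ((xd_contDiffOn ω 0 j (n - 1 - j) ?_).differentiableOn ?_).differentiableAt
      (Ioi_mem_nhds hx)
    · convert hω using 3
      omega
    · norm_cast
      omega
  have hI : ∀ j < n, ∀ c : Fin n, IntegrableOn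
      (fun x : ℝ => (x : ℂ) ^ (s c) * ((negxdOp^[j] ω) x : ℂ)) (Set.Ioi 0) := by
    intro j hj c
    refine integrable_aux _ _ (hcont j hj) ?_
    simpa [negxd_eq, abs_mul] using hint j hj c
  have ht0 : ∀ j < n, ∀ c : Fin n,
      Tendsto (fun x : ℝ => x ^ ((s c).re + 1) * (negxdOp^[j] ω) x)
        (nhdsWithin 0 (Set.Ioi 0)) (nhds 0) := by
    intro j hj c
    have := (hlim0 j hj c).const_mul ((-1 : ℝ) ^ j)
    simpa [negxd_eq, mul_left_comm] using this
  have htt : ∀ j < n, ∀ c : Fin n,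
      Tendsto (fun x : ℝ => x ^ ((s c).re + 1) * (negxdOp^[j] ω) x) atTop (nhds 0) := by
    intro j hj c
    have := (hlimtop j hj c).const_mul ((-1 : ℝ) ^ j)
    simpa [negxd_eq, mul_left_comm] using this
  have hM : ∀ c : Fin n, ∀ j < n,
      ∫ x in Set.Ioi (0 : ℝ), (x : ℂ) ^ (s c) * ((negxdOp^[j] ω) x : ℂ) =
        (s c + 1) ^ j * mellinPos ω (s c + 1) := by
    intro c j
    induction j with
    | zero => intro _; simp [mellinPos]
    | succ j ih =>
      intro hj
      have h2 := hI (j + 1) hj c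
      rw [Function.iterate_succ_apply'] at h2 ⊢
      rw [ibp _ _ (hdiff j hj) (hI j (by omega) c) h2 (ht0 j (by omega) c) (htt j (by omega) c),
        ih (by omega)]
      ring
  have hA := andreief n (volume.restrict (Set.Ioi (0 : ℝ)))
    (fun b x => ((negxdOp^[(b : ℕ)] ω) x : ℂ)) (fun b x => (x : ℂ) ^ (s b))
    (fun b c => by simpa only [mul_comm, IntegrableOn] using hI b b.2 c)
  rw [volume_pi, Measure.restrict_pi_pi, hA, ← mul_assoc, one_div, inv_mul_cancel₀ hfc, one_mul,
    vdm_eq, ← Matrix.det_vandermonde_add s 1, mul_comm, ← Matrix.det_mul_column,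
    ← Matrix.det_transpose]
  congr 1
  ext i j
  simp only [Matrix.transpose_apply, Matrix.of_apply, Matrix.vandermonde_apply]
  rw [mul_comm (mellinPos _ _), ← hM i j j.2]
  simp only [mul_comm]

end RMT
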